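/- For a linear system, the UKF gain and covariances are independent of the unscented-transform parameters: for any nonzero real numbers α₁, α₂ and any n×n matrices B₁, B₂ with B₁·B₁ᵀ = n·P and B₂·B₂ᵀ = n·P, the resulting UKF quantities coincide: P_prior^UKF(α₁, B₁) = P_prior^UKF(α₂, B₂), P_z^UKF(α₁, B₁) = P_z^UKF(α₂, B₂), and P_ez^UKF(α₁, B₁) = P_ez^UKF(α₂, B₂). -/

import Mathlib

open Matrix

/-- UKF weight vector `W ∈ ℝ^{2n+1}`. -/
noncomputable def ukfW (n : ℕ) (α : ℝ) : Fin (2*n+1) → ℝ :=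
  fun i => if i.val = 0 then (α^2 - 1)/α^2 else 1/(2*α^2*n)

/-- Perturbation matrix `Δ(α, B)`: first column 0, next n columns `α·bᵢ`,
last n columns `−α·bᵢ`. -/
noncomputable def ukfDelta (n : ℕ) (α : ℝ) (B : Matrix (Fin n) (Fin n) ℝ) :
    Matrix (Fin n) (Fin (2*n+1)) ℝ :=
  Matrix.of fun i j =>
    if h0 : j.val = 0 then 0
    else if h1 : j.val ≤ n then α * B i ⟨j.val - 1, by omega⟩
    else -(α * B i ⟨j.val - n - 1, by have := j.isLt; omega⟩)

/-- Sigma-point matrix `X(x̂, α, B)`: j-th column is `x̂` plus the j-th column of `Δ(α, B)`. -/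
noncomputable def sigmaPts {n : ℕ} (xhat : Fin n → ℝ) (α : ℝ)
    (B : Matrix (Fin n) (Fin n) ℝ) : Matrix (Fin n) (Fin (2*n+1)) ℝ :=
  Matrix.of fun i j => xhat i + ukfDelta n α B i j

/-- Affine propagation of an ensemble: j-th column of the result is `A·(j-th column of X) + u`. -/
noncomputable def propagate {n : ℕ} (A : Matrix (Fin n) (Fin n) ℝ) (u : Fin n → ℝ)
    (X : Matrix (Fin n) (Fin (2*n+1)) ℝ) : Matrix (Fin n) (Fin (2*n+1)) ℝ :=
  Matrix.of fun i j => A.mulVec (fun r => X r j) i + u i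

/-- Deviation matrix `X̃ = X − (X·W)·1ᵀ`. -/
noncomputable def devMat {q m : ℕ} (w : Fin m → ℝ) (X : Matrix (Fin q) (Fin m) ℝ) :
    Matrix (Fin q) (Fin m) ℝ :=
  X - Matrix.vecMulVec (X.mulVec w) (fun _ => 1)

/-- Posterior covariance as a function of the gain:
`P(K̂) = P_prior + K̂·R̄·K̂ᵀ − K̂·C·P_prior − P_prior·Cᵀ·K̂ᵀ`. -/
noncomputable def postCov {n p : ℕ} (Pprior : Matrix (Fin n) (Fin n) ℝ)
    (C : Matrix (Fin p) (Fin n) ℝ) (Rbar : Matrix (Fin p) (Fin p) ℝ)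
    (K : Matrix (Fin n) (Fin p) ℝ) : Matrix (Fin n) (Fin n) ℝ :=
  Pprior + K * Rbar * Kᵀ - K * C * Pprior - Pprior * Cᵀ * Kᵀ

theorem Fin.sum_univ_two_mul_add_one {M : Type*} [AddCommMonoid M] (n : ℕ)
    (f : Fin (2 * n + 1) → M) :
    ∑ j, f j = f 0 + (∑ k : Fin n, f ⟨k.val + 1, by omega⟩ +
      ∑ k : Fin n, f ⟨n + k.val + 1, by omega⟩) := by
  rw [Fin.sum_univ_succ, ← (finCongr (two_mul n).symm).sum_comp, Fin.sum_univ_add]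
  rfl

section UKF

variable {n : ℕ} (α : ℝ) (B : Matrix (Fin n) (Fin n) ℝ)

theorem ukfDelta_zero (i : Fin n) : ukfDelta n α B i 0 = 0 := by
  simp [ukfDelta]

theorem ukfDelta_pos (i k : Fin n) :
    ukfDelta n α B i ⟨k.val + 1, by omega⟩ = α * B i k := by
  simp [ukfDelta]

theorem ukfDelta_neg (i k : Fin n) :
    ukfDelta n α B i ⟨n + k.val + 1, by omega⟩ = -(α * B i k) := by
  have h : ¬ n + k.val + 1 ≤ n := by omega
  have h' : n + k.val + 1 - n - 1 = k.val := by omega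
  simp [ukfDelta, h, h']

theorem sum_ukfW (hn : 0 < n) (hα : α ≠ 0) : ∑ j, ukfW n α j = 1 := by
  have : (n : ℝ) ≠ 0 := by positivity
  rw [Fin.sum_univ_two_mul_add_one]
  simp [ukfW]
  field_simp
  ring

theorem ukfDelta_mulVec_ukfW : ukfDelta n α B *ᵥ ukfW n α = 0 := by
  ext i
  simp only [mulVec, dotProduct, Fin.sum_univ_two_mul_add_one, ukfDelta_zero, ukfDelta_pos,
    ukfDelta_neg]
  simp [ukfW]

theorem ukfDelta_mul_diagonal_mul_transpose (hα : α ≠ 0) :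
    ukfDelta n α B * diagonal (ukfW n α) * (ukfDelta n α B)ᵀ = (n : ℝ)⁻¹ • (B * Bᵀ) := by
  ext i j
  rw [mul_apply, Matrix.smul_apply, mul_apply, smul_eq_mul, Finset.mul_sum]
  simp only [mul_diagonal, transpose_apply, Fin.sum_univ_two_mul_add_one, ukfDelta_zero,
    ukfDelta_pos, ukfDelta_neg]
  rw [← Finset.sum_add_distrib, zero_mul, zero_mul, zero_add]
  refine Finset.sum_congr rfl fun k _ => ?_
  simp only [ukfW, Nat.succ_ne_zero, if_false]
  field_simp
  ring

theorem propagate_sigmaPts (A : Matrix (Fin n) (Fin n) ℝ) (u xhat : Fin n → ℝ) :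
    propagate A u (sigmaPts xhat α B) =
      vecMulVec (A *ᵥ xhat + u) (fun _ => 1) + A * ukfDelta n α B := by
  ext i j
  simp only [propagate, sigmaPts, of_apply, mulVec, dotProduct, mul_add, Finset.sum_add_distrib,
    Matrix.add_apply, vecMulVec_apply, Pi.add_apply, mul_apply]
  ring

theorem devMat_vecMulVec_one_add {q m : ℕ} {w : Fin m → ℝ} (hw : ∑ j, w j = 1)
    (v : Fin q → ℝ) {D : Matrix (Fin q) (Fin m) ℝ} (hD : D *ᵥ w = 0) :
    devMat w (vecMulVec v (fun _ => 1) + D) = D := by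
  have hv : vecMulVec v (fun _ => 1) *ᵥ w = v := by
    ext i
    simp [mulVec, dotProduct, vecMulVec_apply, ← Finset.mul_sum, hw]
  rw [devMat, add_mulVec, hD, hv, add_zero, add_sub_cancel_left]

theorem devMat_propagate_sigmaPts (hn : 0 < n) (hα : α ≠ 0) (A : Matrix (Fin n) (Fin n) ℝ)
    (u xhat : Fin n → ℝ) :
    devMat (ukfW n α) (propagate A u (sigmaPts xhat α B)) = A * ukfDelta n α B := by
  rw [propagate_sigmaPts, devMat_vecMulVec_one_add (sum_ukfW α hn hα)]
  rw [← mulVec_mulVec, ukfDelta_mulVec_ukfW, mulVec_zero]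

theorem devMat_mul {p q m : ℕ} (C : Matrix (Fin p) (Fin q) ℝ) (w : Fin m → ℝ)
    (X : Matrix (Fin q) (Fin m) ℝ) : devMat w (C * X) = C * devMat w X := by
  rw [devMat, devMat, Matrix.mul_sub, mul_vecMulVec, mulVec_mulVec]

theorem mul_ukfDelta_mul_diagonal_mul_transpose (hn : 0 < n) (hα : α ≠ 0)
    {P : Matrix (Fin n) (Fin n) ℝ} (hB : B * Bᵀ = (n : ℝ) • P) {p q : ℕ}
    (F : Matrix (Fin p) (Fin n) ℝ) (G : Matrix (Fin q) (Fin n) ℝ) :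
    F * ukfDelta n α B * diagonal (ukfW n α) * (G * ukfDelta n α B)ᵀ = F * P * Gᵀ := by
  have hn' : (n : ℝ) ≠ 0 := by positivity
  have h := ukfDelta_mul_diagonal_mul_transpose α B hα
  rw [hB, inv_smul_smul₀ hn'] at h
  rw [← h]
  simp only [transpose_mul, Matrix.mul_assoc]

end UKF

theorem stmt15 {n p : ℕ} (hn : 0 < n) (hp : 0 < p)
    (A : Matrix (Fin n) (Fin n) ℝ) (C : Matrix (Fin p) (Fin n) ℝ)
    (Q P : Matrix (Fin n) (Fin n) ℝ) (R : Matrix (Fin p) (Fin p) ℝ)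
    (hQ : Q.PosSemidef) (hR : R.PosDef) (hP : P.PosSemidef)
    (xhat u : Fin n → ℝ)
    (α₁ α₂ : ℝ) (hα₁ : α₁ ≠ 0) (hα₂ : α₂ ≠ 0)
    (B₁ B₂ : Matrix (Fin n) (Fin n) ℝ)
    (hB₁ : B₁ * B₁ᵀ = (n : ℝ) • P) (hB₂ : B₂ * B₂ᵀ = (n : ℝ) • P)
    (X₁ : Matrix (Fin n) (Fin (2*n+1)) ℝ) (hX₁ : X₁ = propagate A u (sigmaPts xhat α₁ B₁))
    (X₂ : Matrix (Fin n) (Fin (2*n+1)) ℝ) (hX₂ : X₂ = propagate A u (sigmaPts xhat α₂ B₂))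
    (Xt₁ : Matrix (Fin n) (Fin (2*n+1)) ℝ) (hXt₁ : Xt₁ = devMat (ukfW n α₁) X₁)
    (Xt₂ : Matrix (Fin n) (Fin (2*n+1)) ℝ) (hXt₂ : Xt₂ = devMat (ukfW n α₂) X₂)
    (Yt₁ : Matrix (Fin p) (Fin (2*n+1)) ℝ) (hYt₁ : Yt₁ = devMat (ukfW n α₁) (C * X₁))
    (Yt₂ : Matrix (Fin p) (Fin (2*n+1)) ℝ) (hYt₂ : Yt₂ = devMat (ukfW n α₂) (C * X₂)) :
    Xt₁ * Matrix.diagonal (ukfW n α₁) * Xt₁ᵀ + Q =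
      Xt₂ * Matrix.diagonal (ukfW n α₂) * Xt₂ᵀ + Q ∧
    Yt₁ * Matrix.diagonal (ukfW n α₁) * Yt₁ᵀ + R =
      Yt₂ * Matrix.diagonal (ukfW n α₂) * Yt₂ᵀ + R ∧
    Xt₁ * Matrix.diagonal (ukfW n α₁) * Yt₁ᵀ =
      Xt₂ * Matrix.diagonal (ukfW n α₂) * Yt₂ᵀ := by
  subst hX₁ hX₂ hXt₁ hXt₂ hYt₁ hYt₂
  simp only [devMat_mul, devMat_propagate_sigmaPts _ _ hn hα₁, devMat_propagate_sigmaPts _ _ hn hα₂,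
    ← Matrix.mul_assoc C A, mul_ukfDelta_mul_diagonal_mul_transpose _ _ hn hα₁ hB₁,
    mul_ukfDelta_mul_diagonal_mul_transpose _ _ hn hα₂ hB₂, and_self]
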